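/- For all integers k ≥ 2 and ℓ ≥ k+1 and all n ≥ ℓ, every edge-coloring of the complete k-uniform hypergraph K_n^k in which each tight cycle on ℓ vertices receives at least k+1 distinct colors uses at least 2(n−k+1)/(kℓ+ℓ−1) colors; that is, f(K_n^k, C_ℓ^k, k+1) ≥ 2n/(kℓ+ℓ−1) + O(1). -/

import Mathlib

open Finset

/-- The number of colors used by an edge-coloring `c` of the complete `k`-uniform
hypergraph `K_n^k`. -/
def usedColorsHyp (n k : ℕ) (c : Finset (Fin n) → ℕ) : ℕ :=
  (((Finset.univ : Finset (Fin n)).powersetCard k).image c).card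

/-- `v` lists `ℓ` distinct vertices: it is injective on `{0, …, ℓ-1}`. -/
def InjOnFirst (n ℓ : ℕ) (v : ℕ → Fin n) : Prop :=
  ∀ i j, i < ℓ → j < ℓ → v i = v j → i = j

/-- The number of distinct colors on the `k`-uniform tight cycle with cyclic vertex order
`v 0, v 1, …, v (ℓ-1)`: its edges are the sets of `k` cyclically consecutive vertices. -/
def tightCycleColorCount (n k ℓ : ℕ) (c : Finset (Fin n) → ℕ) (v : ℕ → Fin n) : ℕ :=
  ((Finset.range ℓ).image fun i =>
    c ((Finset.range k).image fun j => v ((i + j) % ℓ))).card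

/-- The vertex `y` lies strictly inside the clockwise arc from `a` to `b`. -/
def InArc {n : ℕ} (a b y : Fin n) : Prop :=
  (a < y ∧ y < b) ∨ (b < a ∧ (a < y ∨ y < b))

/-- Coordinates `2P` and `2P+1` of a `k`-tuple form its `P`-th pair (when `k` is odd, the last
coordinate is alone). `FreeAt v P y` says that `y` may replace an entry of the `P`-th pair of `v`:
it lies inside the arc spanned by the pair, or beyond the unpaired entry. -/
def FreeAt {k n : ℕ} (v : Fin k → Fin n) (P : ℕ) (y : Fin n) : Prop :=
  if h : 2 * P + 1 < k then InArc (v ⟨2 * P, by omega⟩) (v ⟨2 * P + 1, h⟩) y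
  else if h : 2 * P < k then v ⟨2 * P, h⟩ < y else False

/-- The labels in the same pair as `i`. -/
def pairLabels {k : ℕ} (i : Fin k) : Finset (Fin k) :=
  univ.filter fun l => l.val / 2 = i.val / 2

theorem not_freeAt_self {k n : ℕ} (v : Fin k → Fin n) (i : Fin k) :
    ¬ FreeAt v (i.val / 2) (v i) := by
  obtain ⟨i, hi⟩ := i
  rcases Nat.even_or_odd' i with ⟨P, rfl | rfl⟩
  · have : 2 * P / 2 = P := by omega
    simp only [FreeAt, InArc, this]
    split_ifs
    · simp; omega
    · simp
  · have : (2 * P + 1) / 2 = P := by omega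
    simp only [FreeAt, InArc, this, hi]
    simp; omega

theorem freeAt_or_freeAt {k n : ℕ} (v v' : Fin k → Fin n) (hv : Function.Injective v)
    (hv' : Function.Injective v') (i : Fin k) (hoff : ∀ j, j ≠ i → v' j = v j)
    (hne : v i ≠ v' i) :
    FreeAt v (i.val / 2) (v' i) ∨ FreeAt v' (i.val / 2) (v i) := by
  obtain ⟨i, hi⟩ := i
  rcases Nat.even_or_odd' i with ⟨P, rfl | rfl⟩
  · have hP : 2 * P / 2 = P := by omega
    simp only [FreeAt, InArc, hP, hi]
    split_ifs with h
    · have e := hoff ⟨2 * P + 1, h⟩ (by simp)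
      have n1 := hv.ne (a₁ := ⟨2 * P, hi⟩) (a₂ := ⟨2 * P + 1, h⟩) (by simp)
      have n2 := hv'.ne (a₁ := ⟨2 * P, hi⟩) (a₂ := ⟨2 * P + 1, h⟩) (by simp)
      rw [e] at n2 ⊢
      omega
    · omega
  · have hP : (2 * P + 1) / 2 = P := by omega
    have h0 : 2 * P < k := by omega
    simp only [FreeAt, InArc, hP, hi]
    have e := hoff ⟨2 * P, h0⟩ (by simp)
    have n1 := hv.ne (a₁ := ⟨2 * P, h0⟩) (a₂ := ⟨2 * P + 1, hi⟩) (by simp)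
    have n2 := hv'.ne (a₁ := ⟨2 * P, h0⟩) (a₂ := ⟨2 * P + 1, hi⟩) (by simp)
    rw [e] at n2
    simp only [e, dif_pos]
    omega

theorem FreeAt.of_move {k n : ℕ} (v v' : Fin k → Fin n) (i : Fin k)
    (hoff : ∀ j, j ≠ i → v' j = v j) (hfree : FreeAt v (i.val / 2) (v' i))
    (P : ℕ) (y : Fin n) (hy : FreeAt v' P y) : FreeAt v P y := by
  by_cases hPi : i.val / 2 = P
  · subst hPi
    obtain ⟨i, hi⟩ := i
    rcases Nat.even_or_odd' i with ⟨P, rfl | rfl⟩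
    · have hP : 2 * P / 2 = P := by omega
      simp only [FreeAt, InArc, hP, hi] at hfree hy ⊢
      split_ifs with h
      · have e := hoff ⟨2 * P + 1, h⟩ (by simp)
        simp only [h, dif_pos, e] at hfree hy
        omega
      · simp only [h, dif_pos, dif_neg, not_false_eq_true] at hfree hy ⊢
        omega
    · have hP : (2 * P + 1) / 2 = P := by omega
      simp only [FreeAt, InArc, hP, hi] at hfree hy ⊢
      have e := hoff ⟨2 * P, by omega⟩ (by simp)
      simp only [dif_pos, e] at hfree hy ⊢
      omega
  · unfold FreeAt at hy ⊢
    split_ifs at hy ⊢ with h h'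
    · rwa [hoff ⟨2 * P, by omega⟩ (by rintro rfl; exact hPi (by simp)),
        hoff ⟨2 * P + 1, h⟩ (by rintro rfl; apply hPi; simp; omega)] at hy
    · rwa [hoff ⟨2 * P, h'⟩ (by rintro rfl; exact hPi (by simp))] at hy

/-- If, for each `p`, any two elements of `X` with the same `p`-th key are `R p`-comparable, and
`X` has more elements than the first `T` key sets together, then `X` contains an `R`-chain with
`T` steps. -/
theorem exists_chain_of_keys {α : Type*} {β : ℕ → Type*} [∀ p, DecidableEq (β p)]
    (R : ℕ → α → α → Prop) (key : ∀ p, α → β p) (d : ℕ → ℕ) (T : ℕ) (X : Finset α)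
    (hR : ∀ p, ∀ x ∈ X, ∀ y ∈ X, key p x = key p y → x ≠ y → R p x y ∨ R p y x)
    (hd : ∀ p, (X.image (key p)).card ≤ d p) (hX : ∑ p ∈ range T, d p < X.card) :
    ∃ x : ℕ → α, (∀ p ≤ T, x p ∈ X) ∧ ∀ p < T, R p (x p) (x (p + 1)) := by
  classical
  induction T generalizing X with
  | zero =>
    obtain ⟨a, ha⟩ := Finset.card_pos.1 (by simpa using hX)
    exact ⟨fun _ => a, fun _ _ => ha, by simp⟩
  | succ T ih =>
    set B := X.filter fun x => ∃ y ∈ X, R T x y with hB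
    have hBX : B ⊆ X := filter_subset _ _
    have hstuck : (X.filter fun x => ¬ ∃ y ∈ X, R T x y).card ≤ d T := by
      refine le_trans ?_ (hd T)
      refine card_le_card_of_injOn (key T)
        (fun x hx => mem_image_of_mem _ (mem_filter.1 hx).1) ?_
      intro x hx y hy hxy
      obtain ⟨hxX, hx⟩ := mem_filter.1 hx
      obtain ⟨hyX, hy⟩ := mem_filter.1 hy
      by_contra hne
      rcases hR T x hxX y hyX hxy hne with h | h
      · exact hx ⟨y, hyX, h⟩
      · exact hy ⟨x, hxX, h⟩
    have hcard := card_filter_add_card_filter_not (s := X) (fun x => ∃ y ∈ X, R T x y)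
    rw [← hB] at hcard
    rw [sum_range_succ] at hX
    obtain ⟨x, hxB, hxR⟩ := ih B (fun p x hx y hy => hR p x (hBX hx) y (hBX hy))
      (fun p => (card_le_card (image_subset_image hBX)).trans (hd p)) (by omega)
    obtain ⟨y, hyX, hy⟩ := (mem_filter.1 (hxB T le_rfl)).2
    refine ⟨fun p => if p ≤ T then x p else y, fun p _ => ?_, fun p hp => ?_⟩
    · by_cases h : p ≤ T
      · simpa [h] using hBX (hxB p h)
      · simpa [h] using hyX
    · rcases Nat.lt_succ_iff_lt_or_eq.1 hp with h | rfl
      · simpa [h.le, Nat.succ_le_of_lt h] using hxR p h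
      · simpa using hy

theorem card_filter_comp_mem {J V L : Type*} [Fintype J] [Fintype V] [Fintype L]
    [DecidableEq V] [DecidableEq L] (s : J ↪ V) (A : J → Finset L) :
    (univ.filter fun φ : V → L => ∀ j, φ (s j) ∈ A j).card
      = (∏ j, (A j).card) * Fintype.card L ^ (Fintype.card V - Fintype.card J) := by
  classical
  set t : V → Finset L := fun x => if h : ∃ j, s j = x then A h.choose else univ with ht
  have hts : ∀ j, t (s j) = A j := by
    intro j
    have h : ∃ j', s j' = s j := ⟨j, rfl⟩
    simp only [ht, dif_pos h]
    rw [s.injective h.choose_spec]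
  have htn : ∀ x, x ∉ univ.map s → t x = univ := by
    intro x hx
    have : ¬ ∃ j, s j = x := by simpa using hx
    simp only [ht, dif_neg this]
  have hset : (univ.filter fun φ : V → L => ∀ j, φ (s j) ∈ A j) = Fintype.piFinset t := by
    ext φ
    simp only [mem_filter, mem_univ, true_and, Fintype.mem_piFinset]
    constructor
    · intro h x
      by_cases hx : x ∈ univ.map s
      · obtain ⟨j, -, rfl⟩ := mem_map.1 hx
        rw [hts]; exact h j
      · rw [htn x hx]; exact mem_univ _
    · intro h j
      rw [← hts]; exact h _
  rw [hset, Fintype.card_piFinset, ← prod_mul_prod_compl (univ.map s), prod_map]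
  congr 1
  · exact prod_congr rfl fun j _ => by rw [hts]
  · rw [prod_congr rfl fun x hx => by rw [htn x (mem_compl.1 hx)], prod_const, card_compl]
    simp

theorem card_filter_prod_comp_mem {J V L : Type*} [Fintype J] [Fintype V] [Fintype L]
    [DecidableEq V] [DecidableEq L] (Q : Finset (J ↪ V)) (A : J → Finset L) :
    (((univ : Finset (V → L)) ×ˢ Q).filter fun x => ∀ j, x.1 (x.2 j) ∈ A j).card
      = Q.card * ((∏ j, (A j).card) * Fintype.card L ^ (Fintype.card V - Fintype.card J)) := by
  classical
  rw [card_filter, sum_product_right, ← smul_eq_mul, ← sum_const]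
  refine sum_congr rfl fun s _ => ?_
  rw [← card_filter_comp_mem s A, card_filter]

theorem two_mul_prod_pairLabels_le {k : ℕ} (i : Fin k) :
    2 * ∏ j : {j // j ≠ i}, (pairLabels j.1).card
      ≤ (∏ j : Fin k, (pairLabels j).card) * (1 + if i.val = k - 1 then 1 else 0) := by
  have hprod : ∏ j : Fin k, (pairLabels j).card
      = (pairLabels i).card * ∏ j : {j // j ≠ i}, (pairLabels j.1).card := by
    rw [← mul_prod_erase univ _ (mem_univ i)]
    congr 1
    exact prod_subtype _ (by simp) _
  rw [hprod]
  have hi : 2 ≤ (pairLabels i).card * (1 + if i.val = k - 1 then 1 else 0) := by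
    split_ifs with h
    · have : 0 < (pairLabels i).card := card_pos.2 ⟨i, by simp [pairLabels]⟩
      omega
    · obtain ⟨i, hik⟩ := i
      simp only at h
      have : 1 < (pairLabels (⟨i, hik⟩ : Fin k)).card := by
        rw [one_lt_card]
        rcases Nat.even_or_odd' i with ⟨P, rfl | rfl⟩
        · exact ⟨⟨2 * P, hik⟩, by simp [pairLabels], ⟨2 * P + 1, by omega⟩,
            by simp [pairLabels]; omega, by simp⟩
        · exact ⟨⟨2 * P, by omega⟩, by simp [pairLabels]; omega, ⟨2 * P + 1, hik⟩,
            by simp [pairLabels], by simp⟩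
      omega
  calc _ ≤ ((pairLabels i).card * (1 + if i.val = k - 1 then 1 else 0)) *
        ∏ j : {j // j ≠ i}, (pairLabels j.1).card := Nat.mul_le_mul_right _ hi
    _ = _ := by ring

theorem mul_sum_mod_eq_pred_le (k T : ℕ) (hk : 0 < k) :
    k * ∑ p ∈ range T, (1 + if p % k = k - 1 then 1 else 0) ≤ (k + 1) * T := by
  have key : k * (∑ p ∈ range T, if p % k = k - 1 then 1 else 0) + T % k = T := by
    induction T with
    | zero => simp
    | succ T ih =>
      rw [sum_range_succ, mul_add]
      have hlt := Nat.mod_lt T hk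
      split_ifs with h
      · have : (T + 1) % k = 0 := by
          rw [← Nat.mod_add_mod, h, Nat.sub_add_cancel hk, Nat.mod_self]
        omega
      · have : (T + 1) % k = T % k + 1 := by
          rw [← Nat.mod_add_mod, Nat.mod_eq_of_lt (by omega)]
        omega
  rw [sum_add_distrib, mul_add]
  simp only [sum_const, card_range, smul_eq_mul, mul_one, add_mul, one_mul]
  omega

/-- A family of `k`-tuples that is large compared with the number of `(k-1)`-tuples contains all
windows of `k` consecutive vertices of some tight path on `k + T` vertices. -/
theorem exists_tight_path {k n : ℕ} (hk : 0 < k) (hkn : k ≤ n) (T : ℕ)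
    (Q : Finset (Fin k ↪ Fin n))
    (hQ : n.descFactorial (k - 1) * ((k + 1) * T) < 2 * Q.card) :
    ∃ w : ℕ → Fin n, InjOnFirst n (k + T) w ∧
      ∀ q ≤ T, ∃ v ∈ Q, (range k).image (fun j => w (q + j)) = univ.image v := by
  classical
  let idx : ℕ → Fin k := fun p => ⟨p % k, Nat.mod_lt p hk⟩
  let X : Finset ((Fin n → Fin k) × (Fin k ↪ Fin n)) :=
    (univ ×ˢ Q).filter fun x => ∀ j, x.1 (x.2 j) ∈ pairLabels j
  let R : ℕ → (Fin n → Fin k) × (Fin k ↪ Fin n) → (Fin n → Fin k) × (Fin k ↪ Fin n) → Prop :=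
    fun p x y => y.1 = x.1 ∧ (∀ j, j ≠ idx p → y.2 j = x.2 j) ∧
      FreeAt x.2 ((idx p).val / 2) (y.2 (idx p))
  let key : ∀ p, (Fin n → Fin k) × (Fin k ↪ Fin n) →
      (Fin n → Fin k) × ({j // j ≠ idx p} ↪ Fin n) :=
    fun p x => (x.1, (Function.Embedding.subtype _).trans x.2)
  let W : ℕ := ∏ j : Fin k, (pairLabels j).card
  let d : ℕ → ℕ := fun p => n.descFactorial (k - 1) *
    ((∏ j : {j // j ≠ idx p}, (pairLabels j.1).card) * k ^ (n - k + 1))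
  have hsub : ∀ p, Fintype.card {j // j ≠ idx p} = k - 1 := fun p => by
    simp [Fintype.card_subtype_compl]
  have hXcard : X.card = Q.card * (W * k ^ (n - k)) := by
    have hcount := card_filter_prod_comp_mem Q (pairLabels (k := k))
    rw [Fintype.card_fin, Fintype.card_fin] at hcount
    rw [← hcount]
    congr!
  have hd : ∀ p, (X.image (key p)).card ≤ d p := by
    intro p
    have hcount := card_filter_prod_comp_mem (univ : Finset ({j // j ≠ idx p} ↪ Fin n))
      (fun j => pairLabels j.1)
    rw [card_univ, Fintype.card_embedding_eq, hsub, Fintype.card_fin, Fintype.card_fin,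
      show n - (k - 1) = n - k + 1 by omega] at hcount
    rw [show d p = _ from hcount.symm]
    apply card_le_card
    intro y hy
    obtain ⟨x, hx, rfl⟩ := mem_image.1 hy
    rw [mem_filter]
    exact ⟨by simp, fun j => (mem_filter.1 hx).2 j.1⟩
  have hR : ∀ p, ∀ x ∈ X, ∀ y ∈ X, key p x = key p y → x ≠ y → R p x y ∨ R p y x := by
    rintro p ⟨φ, v⟩ - ⟨ψ, u⟩ - hkey hne
    obtain ⟨h1, h2⟩ := Prod.mk.inj hkey
    simp only at h1 h2
    subst h1
    have hoff : ∀ j, j ≠ idx p → u j = v j := fun j hj =>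
      (DFunLike.congr_fun h2 ⟨j, hj⟩).symm
    have hi : v (idx p) ≠ u (idx p) := by
      intro h
      apply hne
      congr 1
      ext j
      by_cases hj : j = idx p
      · rw [hj, h]
      · rw [hoff j hj]
    rcases freeAt_or_freeAt v u v.injective u.injective (idx p) hoff hi with h | h
    · exact Or.inl ⟨rfl, hoff, h⟩
    · exact Or.inr ⟨rfl, fun j hj => (hoff j hj).symm, h⟩
  have hW : 0 < W := prod_pos fun j _ => card_pos.2 ⟨j, by simp [pairLabels]⟩
  have hlarge : ∑ p ∈ range T, d p < X.card := by
    have h2 : 2 * ∑ p ∈ range T, d p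
        ≤ n.descFactorial (k - 1) * ((k + 1) * T) * (W * k ^ (n - k)) := by
      calc 2 * ∑ p ∈ range T, d p
          ≤ ∑ p ∈ range T, n.descFactorial (k - 1) * (W * k ^ (n - k)) * k *
              (1 + if p % k = k - 1 then 1 else 0) := by
            rw [mul_sum]
            refine sum_le_sum fun p _ => ?_
            calc 2 * d p = n.descFactorial (k - 1) * k ^ (n - k) * k *
                  (2 * ∏ j : {j // j ≠ idx p}, (pairLabels j.1).card) := by
                  simp only [d, pow_succ]; ring
              _ ≤ n.descFactorial (k - 1) * k ^ (n - k) * k *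
                  (W * (1 + if p % k = k - 1 then 1 else 0)) :=
                  Nat.mul_le_mul_left _ (two_mul_prod_pairLabels_le (idx p))
              _ = _ := by ring
        _ = n.descFactorial (k - 1) * (W * k ^ (n - k)) *
              (k * ∑ p ∈ range T, (1 + if p % k = k - 1 then 1 else 0)) := by
            rw [← mul_sum]; ring
        _ ≤ n.descFactorial (k - 1) * (W * k ^ (n - k)) * ((k + 1) * T) :=
            Nat.mul_le_mul_left _ (mul_sum_mod_eq_pred_le k T hk)
        _ = _ := by ring
    have h3 := Nat.mul_lt_mul_of_pos_right hQ (Nat.mul_pos hW (Nat.pow_pos hk (n := n - k)))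
    refine Nat.lt_of_mul_lt_mul_left (a := 2) (h2.trans_lt ?_)
    rwa [hXcard, ← mul_assoc 2]
  obtain ⟨x, hxX, hxR⟩ := exists_chain_of_keys R key d T X hR hd hlarge
  have hcompat : ∀ p ≤ T, ∀ j, ((x p).1 ((x p).2 j)).val / 2 = j.val / 2 := fun p hp j => by
    simpa [pairLabels] using (mem_filter.1 (hxX p hp)).2 j
  let w : ℕ → Fin n := fun p => (x (p + 1 - k)).2 (idx p)
  let U : ℕ → Fin n → Prop := fun p y => FreeAt (x p).2 (((x p).1 y).val / 2) y
  have hUanti : ∀ p q, p ≤ q → q ≤ T → ∀ y, U q y → U p y := by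
    intro p q hpq
    induction q, hpq using Nat.le_induction with
    | base => exact fun _ y hy => hy
    | succ q hpq ih =>
      intro hq y hy
      obtain ⟨h1, h2, h3⟩ := hxR q hq
      apply ih (by omega)
      simp only [U, h1] at hy ⊢
      exact FreeAt.of_move _ _ _ h2 h3 _ _ hy
  have hnotU : ∀ p ≤ T, ∀ j, ¬ U p ((x p).2 j) := by
    intro p hp j
    simp only [U, hcompat p hp j]
    exact not_freeAt_self _ j
  have hnewU : ∀ p < T, U p ((x (p + 1)).2 (idx p)) := by
    intro p hp
    obtain ⟨h1, h2, h3⟩ := hxR p hp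
    have := hcompat (p + 1) hp (idx p)
    rw [h1] at this
    simpa only [U, this] using h3
  have hwindow : ∀ p q, p + 1 - k ≤ q → q ≤ p → q ≤ T → (x q).2 (idx p) = w p := by
    intro p q hpq
    induction q, hpq using Nat.le_induction with
    | base => exact fun _ _ => rfl
    | succ q hpq ih =>
      intro hqp hqT
      rw [← ih (by omega) (by omega)]
      refine (hxR q hqT).2.1 _ fun h => ?_
      have hmod : p % k = q % k := congrArg Fin.val h
      have hdvd : k ∣ p - q := (Nat.modEq_iff_dvd' (by omega)).1 hmod.symm
      have := Nat.le_of_dvd (by omega) hdvd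
      omega
  have hne : ∀ p q, p < q → q < k + T → w p ≠ w q := by
    intro p q hpq hq heq
    by_cases hqk : q < k
    · simp only [w, show p + 1 - k = 0 by omega, show q + 1 - k = 0 by omega] at heq
      have := congrArg Fin.val ((x 0).2.injective heq)
      simp only [idx, Nat.mod_eq_of_lt hqk, Nat.mod_eq_of_lt (hpq.trans hqk)] at this
      omega
    · have hidx : idx q = idx (q - k) := Fin.ext (Nat.mod_eq_sub_mod (by omega))
      have hU := hnewU (q - k) (by omega)
      rw [← hidx, show q - k + 1 = q + 1 - k by omega] at hU
      change U (q - k) (w q) at hU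
      rw [← heq] at hU
      exact hnotU (p + 1 - k) (by omega) (idx p)
        (hUanti (p + 1 - k) (q - k) (by omega) (by omega) _ hU)
  refine ⟨w, fun i j hi hj hij => ?_, fun q hq => ⟨(x q).2, ?_, ?_⟩⟩
  · rcases lt_trichotomy i j with h | h | h
    · exact absurd hij (hne i j h hj)
    · exact h
    · exact absurd hij.symm (hne j i h hi)
  · exact (mem_product.1 (mem_filter.1 (hxX q hq)).1).2
  · have hinj : Set.InjOn (fun j => w (q + j)) (range k) := by
      intro a ha b hb hab
      have ha := mem_range.1 ha
      have hb := mem_range.1 hb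
      by_contra hne'
      rcases lt_or_gt_of_ne hne' with h | h
      · exact hne (q + a) (q + b) (by omega) (by omega) hab
      · exact hne (q + b) (q + a) (by omega) (by omega) hab.symm
    apply eq_of_subset_of_card_le
    · intro y hy
      obtain ⟨j, hj, rfl⟩ := mem_image.1 hy
      have := mem_range.1 hj
      exact mem_image.2 ⟨idx (q + j), mem_univ _, hwindow _ _ (by omega) (by omega) hq⟩
    · rw [card_image_of_injOn hinj, card_image_of_injective _ (x q).2.injective]
      simp

theorem tightCycleColorCount_le {n k ℓ : ℕ} (hk : 1 ≤ k) (hℓ : k ≤ ℓ) (c : Finset (Fin n) → ℕ)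
    (w : ℕ → Fin n) (a : ℕ)
    (hw : ∀ q ≤ ℓ - k, c ((range k).image fun j => w (q + j)) = a) :
    tightCycleColorCount n k ℓ c w ≤ k := by
  set g : ℕ → ℕ := fun i => c ((range k).image fun j => w ((i + j) % ℓ))
  have hsub : (range ℓ).image g ⊆ insert a ((Ioo (ℓ - k) ℓ).image g) := by
    intro y hy
    obtain ⟨i, hi, rfl⟩ := mem_image.1 hy
    have hi := mem_range.1 hi
    by_cases hik : i ≤ ℓ - k
    · rw [mem_insert]
      left
      rw [← hw i hik]
      refine congrArg c (image_congr fun j hj => ?_)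
      have : j < k := by simpa using hj
      rw [Nat.mod_eq_of_lt (by omega)]
    · exact mem_insert_of_mem (mem_image_of_mem _ (mem_Ioo.2 ⟨by omega, hi⟩))
  calc tightCycleColorCount n k ℓ c w ≤ _ := card_le_card hsub
    _ ≤ _ := card_insert_le _ _
    _ ≤ (Ioo (ℓ - k) ℓ).card + 1 := Nat.add_le_add_right card_image_le _
    _ ≤ k := by rw [Nat.card_Ioo]; omega

/-- For `k ≥ 2`, `ℓ ≥ k+1`, `n ≥ ℓ`, every edge-coloring of `K_n^k` in
which every tight cycle on `ℓ` vertices receives at least `k+1` distinct colors uses at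
least `2(n−k+1)/(kℓ+ℓ−1)` colors. -/
theorem generalized_ramsey_tight_cycle_lower (k ℓ n : ℕ) (hk : 2 ≤ k)
    (hℓ : k + 1 ≤ ℓ) (hn : ℓ ≤ n) (c : Finset (Fin n) → ℕ)
    (h : ∀ v : ℕ → Fin n, InjOnFirst n ℓ v → k + 1 ≤ tightCycleColorCount n k ℓ c v) :
    2 * ((n : ℝ) - k + 1) / ((k : ℝ) * ℓ + ℓ - 1) ≤ usedColorsHyp n k c := by
  classical
  set D := n.descFactorial (k - 1) with hD
  have hDpos : 0 < D := Nat.descFactorial_pos.2 (by omega)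
  have hclass : ∀ a, 2 * (univ.filter fun v : Fin k ↪ Fin n => c (univ.image v) = a).card
      ≤ D * ((k + 1) * (ℓ - k)) := by
    intro a
    by_contra! hlt
    obtain ⟨w, hinj, hw⟩ := exists_tight_path (by omega) (by omega : k ≤ n) (ℓ - k) _ hlt
    rw [show k + (ℓ - k) = ℓ by omega] at hinj
    have := tightCycleColorCount_le (k := k) (ℓ := ℓ) (by omega) (by omega) c w a fun q hq => by
      obtain ⟨v, hv, hwv⟩ := hw q hq
      rw [hwv]
      exact (mem_filter.1 hv).2
    have := h w hinj
    omega
  have hfib := card_eq_sum_card_fiberwise (s := (univ : Finset (Fin k ↪ Fin n)))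
    (f := fun v : Fin k ↪ Fin n => c (univ.image v))
    (t := ((univ : Finset (Fin n)).powersetCard k).image c) fun v _ =>
      mem_image_of_mem _ (mem_powersetCard.2 ⟨subset_univ _, by
        rw [card_image_of_injective _ v.injective]; simp⟩)
  have hdesc : n.descFactorial k = (n - k + 1) * D := by
    obtain ⟨m, rfl⟩ : ∃ m, k = m + 1 := ⟨k - 1, by omega⟩
    rw [Nat.descFactorial_succ, hD, Nat.add_sub_cancel, show n - (m + 1) + 1 = n - m by omega]
  rw [card_univ, Fintype.card_embedding_eq, Fintype.card_fin, Fintype.card_fin, hdesc] at hfib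
  have hmul : D * (2 * (n - k + 1)) ≤ D * (usedColorsHyp n k c * ((k + 1) * (ℓ - k))) := by
    calc D * (2 * (n - k + 1)) = 2 * ((n - k + 1) * D) := by ring
      _ ≤ ∑ _a ∈ ((univ : Finset (Fin n)).powersetCard k).image c,
            D * ((k + 1) * (ℓ - k)) := by
          rw [hfib, mul_sum]
          exact sum_le_sum fun a _ => hclass a
      _ = _ := by rw [sum_const, smul_eq_mul, usedColorsHyp]; ring
  have hnat := Nat.le_of_mul_le_mul_left hmul hDpos
  have hreal : 2 * ((n : ℝ) - k + 1) ≤ usedColorsHyp n k c * (((k : ℝ) + 1) * (ℓ - k)) := by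
    have := (Nat.cast_le (α := ℝ)).2 hnat
    push_cast [Nat.cast_sub (show k ≤ n by omega), Nat.cast_sub (show k ≤ ℓ by omega)] at this
    exact this
  have hk' : (2 : ℝ) ≤ k := by exact_mod_cast hk
  have hℓ' : (k : ℝ) + 1 ≤ ℓ := by exact_mod_cast hℓ
  rw [div_le_iff₀ (by nlinarith)]
  refine hreal.trans (mul_le_mul_of_nonneg_left ?_ (Nat.cast_nonneg _))
  nlinarith
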